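/- Let A be a commutative ring, S a set, α₁,…,α_r : S → A, and w₁, w₂ ∈ F_S. Then ℓ_{α₁|…|α_r}(w₁·w₂) = Σ_{k=0}^{r} ℓ_{α₁|…|α_k}(w₁) · ℓ_{α_{k+1}|…|α_r}(w₂), where the summands with k = 0 and k = r use the convention that the empty letter-braiding number equals 1. -/

import Mathlib

open scoped BigOperators

/-- Signed evaluation of `α : S → A` on a letter `(s, ε)`. -/
def sev {A : Type*} [CommRing A] {S : Type*} (α : S → A) (l : S × Bool) : A :=
  if l.2 then α l.1 else - α l.1

/-- The relation `i <_w j` on positions of the word `w`: `i < j` if the `i`-th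
letter is positive, and `i ≤ j` if it is negative. -/
def ltw {S : Type*} (w : List (S × Bool)) (p q : Fin w.length) : Bool :=
  if (w.get p).2 then decide ((p : ℕ) < (q : ℕ)) else decide ((p : ℕ) ≤ (q : ℕ))

/-- Letter-braiding number of a word `w` with respect to a list of functions
`α₁,…,α_r : S → A`: the sum over all sequences of positions
`i₁ <_w i₂ <_w ⋯ <_w i_r` of the products `∏_j α_j(s_{i_j}, ε_{i_j})`.
For `r = 0` it equals `1`. -/
def lbnWord (A : Type*) [CommRing A] {S : Type*} (w : List (S × Bool))
    (αs : List (S → A)) : A :=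
  ∑ i ∈ Finset.univ.filter
      (fun i : Fin αs.length → Fin w.length =>
        ∀ a b : Fin αs.length, (a : ℕ) + 1 = (b : ℕ) → ltw w (i a) (i b) = true),
    ∏ j : Fin αs.length, sev (αs.get j) (w.get (i j))

/-- Letter-braiding number of an element of the free group, computed from its
reduced word. -/
def lbn (A : Type*) [CommRing A] {S : Type*} [DecidableEq S] (g : FreeGroup S)
    (αs : List (S → A)) : A :=
  lbnWord A g.toWord αs

/-- The sum defining `lbnWord`, over `<_w`-chains whose first position satisfies `P`,
computed by recursion on the list of functions. -/
def chainSum (A : Type*) [CommRing A] {S : Type*} (w : List (S × Bool)) :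
    List (S → A) → (Fin w.length → Bool) → A
  | [], _ => 1
  | α :: αs, P => ∑ q, if P q then sev α (w.get q) * chainSum A w αs (ltw w q) else 0

section

variable {A : Type*} [CommRing A] {S : Type*}

theorem forall_consecutive_cons {X : Type*} {n : ℕ} (r : X → X → Bool) (q : X) (i : Fin n → X) :
    (∀ a b : Fin (n + 1), (a : ℕ) + 1 = (b : ℕ) →
        r (Fin.cons (α := fun _ => X) q i a) (Fin.cons (α := fun _ => X) q i b) = true) ↔
      (∀ a b : Fin n, (a : ℕ) + 1 = (b : ℕ) → r (i a) (i b) = true) ∧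
        ∀ b : Fin n, (b : ℕ) = 0 → r q (i b) = true := by
  constructor
  · refine fun h => ⟨fun a b hab => ?_, fun b hb => ?_⟩
    · simpa using h a.succ b.succ (by simpa using hab)
    · simpa using h 0 b.succ (by simp [hb])
  · rintro ⟨h₁, h₂⟩ a b hab
    induction b using Fin.cases with
    | zero => simp at hab
    | succ b =>
      induction a using Fin.cases with
      | zero => simpa using h₂ b (by simpa using hab.symm)
      | succ a => simpa using h₁ a b (by simpa using hab)

theorem sum_chains_eq_chainSum (w : List (S × Bool)) (αs : List (S → A))
    (P : Fin w.length → Bool) :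
    (∑ i : Fin αs.length → Fin w.length,
      if (∀ a b : Fin αs.length, (a : ℕ) + 1 = (b : ℕ) → ltw w (i a) (i b) = true) ∧
          ∀ b : Fin αs.length, (b : ℕ) = 0 → P (i b) = true
        then ∏ j : Fin αs.length, sev (αs.get j) (w.get (i j)) else 0) =
      chainSum A w αs P := by
  induction αs generalizing P with
  | nil => simp [chainSum]
  | cons α αs ih =>
    rw [chainSum]
    refine ((Fin.consEquiv fun _ : Fin (αs.length + 1) => Fin w.length).sum_comp _).symm.trans ?_
    rw [Fintype.sum_prod_type]
    refine Finset.sum_congr rfl fun q _ => ?_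
    have hprod (i : Fin αs.length → Fin w.length) :
        ∏ j : Fin (αs.length + 1), sev ((α :: αs).get j)
          (w.get (Fin.cons (α := fun _ => Fin w.length) q i j)) =
        sev α (w.get q) * ∏ j, sev (αs.get j) (w.get (i j)) := by
      simp [Fin.prod_univ_succ]
    have hfirst (i : Fin αs.length → Fin w.length) :
        (∀ b : Fin (αs.length + 1), (b : ℕ) = 0 →
          P (Fin.cons (α := fun _ => Fin w.length) q i b) = true) ↔ P q = true := by
      simp
    have hchain (i : Fin αs.length → Fin w.length) :=
      forall_consecutive_cons (ltw w) q i
    rw [← ih, Finset.mul_sum]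
    simp only [Fin.consEquiv_apply, List.length_cons, hprod, hfirst, hchain, mul_ite, mul_zero]
    cases P q <;> simp

theorem lbnWord_eq_chainSum (w : List (S × Bool)) (αs : List (S → A)) :
    lbnWord A w αs = chainSum A w αs fun _ => true := by
  rw [← sum_chains_eq_chainSum, lbnWord, Finset.sum_filter]
  simp

theorem ltw_cons_succ_succ (l : S × Bool) (w : List (S × Bool)) (p q : Fin w.length) :
    ltw (l :: w) p.succ q.succ = ltw w p q := by
  simp [ltw]

theorem chainSum_cons_of_not_zero (l : S × Bool) (w : List (S × Bool)) (αs : List (S → A))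
    (P : Fin (l :: w).length → Bool) (hP : P (0 : Fin (w.length + 1)) = false) :
    chainSum A (l :: w) αs P = chainSum A w αs fun q => P q.succ := by
  induction αs generalizing P with
  | nil => simp [chainSum]
  | cons α αs ih =>
    simp only [chainSum]
    refine (Fin.sum_univ_succ (n := w.length) _).trans ?_
    rw [hP, if_neg Bool.false_ne_true, zero_add]
    refine Finset.sum_congr rfl fun q _ => ?_
    rw [ih _ (by simp [ltw])]
    simp [ltw_cons_succ_succ]

theorem lbnWord_nil_right (w : List (S × Bool)) : lbnWord A w [] = 1 := by
  simp [lbnWord]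

theorem lbnWord_nil_cons (α : S → A) (αs : List (S → A)) : lbnWord A [] (α :: αs) = 0 := by
  simp [lbnWord_eq_chainSum, chainSum]

theorem lbnWord_cons_cons (l : S × Bool) (w : List (S × Bool)) (α : S → A)
    (αs : List (S → A)) :
    lbnWord A (l :: w) (α :: αs) =
      lbnWord A w (α :: αs) + sev α l * lbnWord A (if l.2 then w else l :: w) αs := by
  have hsucc : (∑ q : Fin w.length,
      sev α (w.get q) * chainSum A (l :: w) αs (ltw (l :: w) q.succ)) =
        lbnWord A w (α :: αs) := by
    simp only [lbnWord_eq_chainSum, chainSum, if_true]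
    refine Finset.sum_congr rfl fun q _ => ?_
    rw [chainSum_cons_of_not_zero _ _ _ _ (by simp [ltw])]
    simp only [ltw_cons_succ_succ]
  have hzero : chainSum A (l :: w) αs (ltw (l :: w) (0 : Fin (w.length + 1))) =
      lbnWord A (if l.2 then w else l :: w) αs := by
    rw [lbnWord_eq_chainSum]
    cases h : l.2
    · rw [show ltw (l :: w) (0 : Fin (w.length + 1)) = fun _ => true by funext q; simp [ltw, h]]
      rfl
    · rw [chainSum_cons_of_not_zero _ _ _ _ (by simp [ltw, h])]
      simp [ltw, h]
  rw [← hsucc, ← hzero, lbnWord_eq_chainSum, chainSum]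
  simp only [if_true]
  exact (Fin.sum_univ_succ (n := w.length) _).trans (add_comm _ _)

/-- The product formula for concatenation of words. -/
theorem lbnWord_append (w₁ w₂ : List (S × Bool)) (αs : List (S → A)) :
    lbnWord A (w₁ ++ w₂) αs =
      ∑ k ∈ Finset.range (αs.length + 1),
        lbnWord A w₁ (αs.take k) * lbnWord A w₂ (αs.drop k) := by
  induction w₁ generalizing αs with
  | nil =>
    cases αs with
    | nil => simp [lbnWord_nil_right]
    | cons α αs =>
      rw [Finset.sum_range_succ']
      simp [lbnWord_nil_right, lbnWord_nil_cons]
  | cons l w₁ ihw =>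
    induction αs with
    | nil => simp [lbnWord_nil_right]
    | cons α αs ih =>
      have htail : lbnWord A (if l.2 then w₁ ++ w₂ else l :: (w₁ ++ w₂)) αs =
          ∑ k ∈ Finset.range (αs.length + 1),
            lbnWord A (if l.2 then w₁ else l :: w₁) (αs.take k) *
              lbnWord A w₂ (αs.drop k) := by
        cases h : l.2
        · simpa using ih
        · simpa using ihw αs
      rw [List.cons_append, lbnWord_cons_cons, ihw, htail, Finset.sum_range_succ',
        Finset.sum_range_succ' _ (α :: αs).length]
      simp only [List.length_cons, List.take_succ_cons, List.drop_succ_cons, List.take_zero,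
        List.drop_zero, lbnWord_nil_right, lbnWord_cons_cons l w₁, add_mul,
        Finset.sum_add_distrib, Finset.mul_sum, mul_assoc]
      ring

theorem lbnWord_cancel (s : S) (ε : Bool) (w : List (S × Bool)) (αs : List (S → A)) :
    lbnWord A ((s, ε) :: (s, !ε) :: w) αs = lbnWord A w αs := by
  induction αs with
  | nil => simp [lbnWord_nil_right]
  | cons α αs ih =>
    cases ε
    · simp only [Bool.not_false] at ih
      simp [lbnWord_cons_cons, sev, ih]
    · simp [lbnWord_cons_cons, sev]

theorem lbnWord_eq_of_red {w w' : List (S × Bool)} (h : FreeGroup.Red w w')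
    (αs : List (S → A)) : lbnWord A w αs = lbnWord A w' αs := by
  induction h with
  | refl => rfl
  | tail _ hstep ih =>
    rw [ih]
    cases hstep
    simp only [lbnWord_append, lbnWord_cancel]

end

/-- Product formula for letter-braiding numbers:
`ℓ_{α₁|…|α_r}(w₁·w₂) = Σ_{k=0}^{r} ℓ_{α₁|…|α_k}(w₁) · ℓ_{α_{k+1}|…|α_r}(w₂)`. -/
theorem letterBraiding_mul (A : Type*) [CommRing A] (S : Type*) [DecidableEq S]
    (αs : List (S → A)) (w₁ w₂ : FreeGroup S) :
    lbn A (w₁ * w₂) αs =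
      ∑ k ∈ Finset.range (αs.length + 1),
        lbn A w₁ (αs.take k) * lbn A w₂ (αs.drop k) := by
  simp only [lbn, FreeGroup.toWord_mul, ← lbnWord_eq_of_red FreeGroup.reduce.red, lbnWord_append]
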